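/- arXiv:2206.03348 — 4 statements merged into one kernel-verified Lean document; each statement's English description precedes it below -/
import Mathlib

section
/- Let π = (π_1, …, π_n) be a finite-state deterministic joint policy in an n-agent Markov game. If there exists a set of punishment strategies τ such that π ⋈ τ is an ε-Nash equilibrium, then π ⋈ τ* is an ε-Nash equilibrium, where τ* is a set of best punishment strategies with respect to π. -/
/-- An `n`-agent Markov game: a finite set of states `S`, a finite action set `A i`
for each agent `i`, transition probabilities `P`, a finite horizon `H` and an
initial state `s0`. -/
structure MarkovGame (n : ℕ) where
  S : Type
  fintS : Fintype S
  A : Fin n → Type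
  fintA : ∀ i, Fintype (A i)
  nonemptyA : ∀ i, Nonempty (A i)
  P : S → (∀ i, A i) → PMF S
  H : ℕ
  s0 : S

namespace MarkovGame

variable {n : ℕ}

/-- A (finite) trajectory: an initial state together with a list of
(joint action, next state) steps. -/
abbrev Traj (G : MarkovGame n) : Type := G.S × List ((∀ i, G.A i) × G.S)

variable {G : MarkovGame n}

/-- The length `|ζ|` of a trajectory (its number of steps). -/
def Traj.len (ζ : Traj G) : ℕ := ζ.2.length

/-- The last state of a trajectory. -/
def Traj.last (ζ : Traj G) : G.S :=
  match ζ.2.getLast? with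
  | none => ζ.1
  | some p => p.2

/-- Extend a trajectory by one step. -/
def Traj.extend (ζ : Traj G) (a : ∀ i, G.A i) (s' : G.S) : Traj G :=
  (ζ.1, ζ.2 ++ [(a, s')])

/-- The prefix `ζ_{0:k}` of a trajectory, consisting of its first `k` steps. -/
def Traj.take (ζ : Traj G) (k : ℕ) : Traj G := (ζ.1, ζ.2.take k)

/-- A joint policy maps trajectories (histories) to distributions over joint actions. -/
def JointPolicy (G : MarkovGame n) : Type := Traj G → PMF (∀ i, G.A i)

/-- A policy for agent `i` maps trajectories to distributions over `i`'s actions. -/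
def AgentPolicy (G : MarkovGame n) (i : Fin n) : Type := Traj G → PMF (G.A i)

/-- One step of the game under joint policy `π` from history `ζ`. -/
noncomputable def stepDist (G : MarkovGame n) (π : JointPolicy G) (ζ : Traj G) :
    PMF (Traj G) :=
  (π ζ).bind fun a => (G.P (Traj.last ζ) a).map fun s' => Traj.extend ζ a s'

/-- `trajDist G π t` : the distribution over trajectories with `t` steps induced by
running `π` from the initial state `s0`. -/
noncomputable def trajDist (G : MarkovGame n) (π : JointPolicy G) : ℕ → PMF (Traj G)
  | 0 => PMF.pure (G.s0, ([] : List ((∀ i, G.A i) × G.S)))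
  | t + 1 => (trajDist G π t).bind (G.stepDist π)

/-- The score `J(π)` of a joint policy `π` with respect to a specification `φ`
(a predicate on trajectories): the probability that a trajectory of length `H`
drawn from `D_π` satisfies `φ`. -/
noncomputable def score (G : MarkovGame n) (φ : Traj G → Prop) (π : JointPolicy G) : ℝ :=
  ((trajDist G π G.H).toOuterMeasure {ζ | φ ζ}).toReal

/-- `(π_{-i}, π'_i)` : replace agent `i`'s behaviour in the joint policy `π` by the
agent policy `π'`. -/
noncomputable def replace (π : JointPolicy G) (i : Fin n) (π' : AgentPolicy G i) :
    JointPolicy G :=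
  fun ζ => (π ζ).bind fun a => (π' ζ).map fun ai => Function.update a i ai

/-- `π` is an `ε`-Nash equilibrium with respect to the specifications `φ i`:
no agent can improve its score by more than `ε` by unilaterally deviating. -/
def IsEpsNash (G : MarkovGame n) (φ : ∀ _ : Fin n, Traj G → Prop)
    (π : JointPolicy G) (ε : ℝ) : Prop :=
  ∀ (i : Fin n) (π' : AgentPolicy G i),
    G.score (φ i) (replace π i π') - ε ≤ G.score (φ i) π

/-- A finite-state deterministic joint policy `π = (M, α, σ, m0)`. -/
structure FSPolicy (G : MarkovGame n) where
  Mem : Type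
  fintMem : Fintype Mem
  upd : G.S → (∀ i, G.A i) → Mem → Mem
  act : G.S → Mem → ∀ i, G.A i
  m0 : Mem

namespace FSPolicy

/-- Run the memory update along the steps of a trajectory (the extended memory
update function). -/
def memRun (p : FSPolicy G) : G.S → List ((∀ i, G.A i) × G.S) → p.Mem → p.Mem
  | _, [], m => m
  | s, (a, s') :: rest, m => memRun p s' rest (p.upd s a m)

/-- The (deterministic) joint action played by `p` after history `ζ`. -/
def jointAct (p : FSPolicy G) (ζ : Traj G) : ∀ i, G.A i :=
  p.act (Traj.last ζ) (memRun p ζ.1 ζ.2 p.m0)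

/-- `p` viewed as a joint policy. -/
noncomputable def toJoint (p : FSPolicy G) : JointPolicy G :=
  fun ζ => PMF.pure (p.jointAct ζ)

/-- The joint action at step `k` of `ζ` deviates from what `p` prescribes. -/
def DevAt (p : FSPolicy G) (ζ : Traj G) (k : ℕ) : Prop :=
  ∃ h : k < ζ.2.length, (ζ.2.get ⟨k, h⟩).1 ≠ p.jointAct (Traj.take ζ k)

/-- Some agent has deviated from `p` along `ζ`. -/
def Deviated (p : FSPolicy G) (ζ : Traj G) : Prop := ∃ k, p.DevAt ζ k

/-- The agent that deviated from `p` the earliest along `ζ` (ties at the earliest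
deviation step broken by the fixed consistent rule of taking the least such agent). -/
noncomputable def deviator (p : FSPolicy G) (ζ : Traj G) (h : p.Deviated ζ) : Fin n := by
  classical
  have hk : p.DevAt ζ (Nat.find h) := Nat.find_spec h
  exact (Finset.univ.filter fun j : Fin n =>
      (ζ.2.get ⟨Nat.find h, hk.choose⟩).1 j ≠ p.jointAct (Traj.take ζ (Nat.find h)) j).min'
    (by
      rw [Finset.filter_nonempty_iff]
      by_contra hcon
      push_neg at hcon
      exact hk.choose_spec (funext fun j => hcon j (Finset.mem_univ j)))

end FSPolicy

/-- A set of punishment strategies: `τ i j hij` (for `i ≠ j`) is the policy that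
agent `i` uses to punish agent `j` once `j` has deviated. -/
def PunishmentStrategies (G : MarkovGame n) : Type :=
  ∀ (i j : Fin n), i ≠ j → AgentPolicy G i

/-- Independent product of a `Fin`-indexed family of distributions. -/
noncomputable def pmfPi : {m : ℕ} → {A : Fin m → Type} → (∀ i, PMF (A i)) → PMF (∀ i, A i)
  | 0, _, _ => PMF.pure fun i => i.elim0
  | _ + 1, _, d => (d 0).bind fun a0 => (pmfPi fun i => d i.succ).map fun r => Fin.cons a0 r

/-- The joint policy `π ⋈ τ`: each agent follows `p` as long as every past joint
action agrees with `p`; once some agent has deviated, every agent `i` plays the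
punishment strategy `τ i j` against the agent `j` that deviated the earliest. -/
noncomputable def FSPolicy.compose (p : FSPolicy G) (τ : PunishmentStrategies G) :
    JointPolicy G := fun ζ => by
  classical
  exact
    if h : p.Deviated ζ then
      pmfPi fun i =>
        if hij : i ≠ p.deviator ζ h then τ i (p.deviator ζ h) hij ζ
        else PMF.pure (p.jointAct ζ i)
    else PMF.pure (p.jointAct ζ)

end MarkovGame

namespace MarkovGame

variable {n : ℕ} {G : MarkovGame n}

/-- Extending a history by the prescribed joint action introduces no deviation. -/
theorem FSPolicy.not_deviated_extend (p : FSPolicy G) {ζ : Traj G} (h : ¬ p.Deviated ζ)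
    (s' : G.S) : ¬ p.Deviated (Traj.extend ζ (p.jointAct ζ) s') := by
  rintro ⟨k, hk, hne⟩
  have hk' : k < ζ.2.length + 1 := by simpa [Traj.extend] using hk
  rcases Nat.lt_succ_iff_lt_or_eq.mp hk' with hlt | rfl
  · refine h ⟨k, hlt, ?_⟩
    simpa [Traj.extend, Traj.take, List.getElem_append_left hlt,
      List.take_append_of_le_length hlt.le] using hne
  · simp [Traj.extend, Traj.take] at hne

/-- On histories without deviations, `π ⋈ τ` plays `π`. -/
theorem FSPolicy.compose_of_not_deviated (p : FSPolicy G) (τ : PunishmentStrategies G)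
    {ζ : Traj G} (h : ¬ p.Deviated ζ) : p.compose τ ζ = p.toJoint ζ := by
  simp [FSPolicy.compose, FSPolicy.toJoint, h]

/-- Running a deterministic policy produces no deviation from it. -/
theorem FSPolicy.not_deviated_of_mem_support (p : FSPolicy G) (t : ℕ) :
    ∀ ζ ∈ (G.trajDist p.toJoint t).support, ¬ p.Deviated ζ := by
  induction t with
  | zero =>
    intro ζ hζ
    rw [trajDist, PMF.mem_support_pure_iff] at hζ
    subst hζ
    rintro ⟨k, hk, -⟩
    simp at hk
  | succ t ih =>
    intro ζ hζ
    rw [trajDist, PMF.mem_support_bind_iff] at hζ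
    obtain ⟨ζ', hζ', hstep⟩ := hζ
    rw [stepDist, FSPolicy.toJoint, PMF.pure_bind, PMF.mem_support_map_iff] at hstep
    obtain ⟨s', -, rfl⟩ := hstep
    exact p.not_deviated_extend (ih ζ' hζ') s'

/-- The trajectory distribution of `π ⋈ τ` is that of `π`. -/
theorem FSPolicy.trajDist_compose (p : FSPolicy G) (τ : PunishmentStrategies G) (t : ℕ) :
    G.trajDist (p.compose τ) t = G.trajDist p.toJoint t := by
  induction t with
  | zero => rfl
  | succ t ih =>
    rw [trajDist, trajDist, ih]
    ext ζ
    rw [PMF.bind_apply, PMF.bind_apply]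
    refine tsum_congr fun ζ' => ?_
    by_cases hζ' : ζ' ∈ (G.trajDist p.toJoint t).support
    · rw [stepDist, stepDist,
        p.compose_of_not_deviated τ (p.not_deviated_of_mem_support t ζ' hζ')]
    · rw [(PMF.apply_eq_zero_iff _ _).mpr hζ', zero_mul, zero_mul]

/-- The score of `π ⋈ τ` is that of `π`. -/
theorem FSPolicy.score_compose (p : FSPolicy G) (τ : PunishmentStrategies G)
    (ψ : Traj G → Prop) : G.score ψ (p.compose τ) = G.score ψ p.toJoint := by
  rw [score, score, p.trajDist_compose]

end MarkovGame

open MarkovGame in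
/-- Let `π = (π_1, …, π_n)` be a finite-state deterministic joint
policy in an `n`-agent Markov game. If there exists a set of punishment strategies
`τ` such that `π ⋈ τ` is an `ε`-Nash equilibrium, then `π ⋈ τ*` is an `ε`-Nash
equilibrium, where `τ*` is a set of best punishment strategies with respect to `π`
(i.e. `br j` is a best-response map and, for every agent `j`, `τ*` minimizes over
all `τ` the value `J_j((π ⋈ τ)_{-j}, br_j(π ⋈ τ))`). -/
theorem best_punishment_preserves_nash
    {n : ℕ} {G : MarkovGame n} (φ : ∀ _ : Fin n, Traj G → Prop) (ε : ℝ)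
    (p : FSPolicy G)
    (br : ∀ j : Fin n, JointPolicy G → AgentPolicy G j)
    (hbr : ∀ (j : Fin n) (π' : JointPolicy G) (π'' : AgentPolicy G j),
      G.score (φ j) (replace π' j π'') ≤ G.score (φ j) (replace π' j (br j π')))
    (τstar : PunishmentStrategies G)
    (hτstar : ∀ (j : Fin n) (τ : PunishmentStrategies G),
      G.score (φ j) (replace (p.compose τstar) j (br j (p.compose τstar))) ≤
        G.score (φ j) (replace (p.compose τ) j (br j (p.compose τ))))
    (h : ∃ τ : PunishmentStrategies G, G.IsEpsNash φ (p.compose τ) ε) :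
    G.IsEpsNash φ (p.compose τstar) ε := by
  obtain ⟨τ, hτ⟩ := h
  intro i π'
  have h₁ := hbr i (p.compose τstar) π'
  have h₂ := hτstar i τ
  have h₃ := hτ i (br i (p.compose τ))
  rw [p.score_compose] at h₃ ⊢
  linarith
end

section
/- Let π be a finite-state deterministic joint policy in an n-agent Markov game, let j be an agent, and let τ and τ' be two sets of punishment strategies with τ[j] = τ'[j]. Then for every alternate policy π'_j of agent j, J_j((π ⋈ τ)_{−j}, π'_j) = J_j((π ⋈ τ')_{−j}, π'_j). In particular, the optimal deviation value max_{π'_j} J_j((π ⋈ τ)_{−j}, π'_j) depends only on τ[j] and not on τ ∖ τ[j]. -/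
namespace MarkovGame

variable {n : ℕ} {G : MarkovGame n}

theorem Traj.take_extend (ζ : Traj G) (a : ∀ i, G.A i) (s' : G.S) {k : ℕ}
    (hk : k ≤ ζ.2.length) : (ζ.extend a s').take k = ζ.take k := by
  simp [Traj.take, Traj.extend, List.take_append_of_le_length hk]

theorem Traj.take_length (ζ : Traj G) : ζ.take ζ.2.length = ζ := by
  simp [Traj.take]

theorem FSPolicy.devAt_extend_iff (p : FSPolicy G) (ζ : Traj G) (a : ∀ i, G.A i) (s' : G.S)
    {k : ℕ} (hk : k < ζ.2.length) : p.DevAt (ζ.extend a s') k ↔ p.DevAt ζ k := by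
  have hk' : k < (ζ.extend a s').2.length := by
    simp only [Traj.extend, List.length_append, List.length_singleton]; omega
  have hget : (ζ.extend a s').2.get ⟨k, hk'⟩ = ζ.2.get ⟨k, hk⟩ := by
    simp [Traj.extend, List.getElem_append_left hk]
  simp only [FSPolicy.DevAt, Traj.take_extend ζ a s' hk.le, exists_prop_of_true hk',
    exists_prop_of_true hk, hget]

/-- At the first deviation from `p` along `ζ` (if any), no agent other than `j` deviates. -/
def FSPolicy.FirstDeviatorOnly (p : FSPolicy G) (j : Fin n) (ζ : Traj G) : Prop :=
  ∀ (k : ℕ) (hk : k < ζ.2.length), (∀ l < k, ¬ p.DevAt ζ l) →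
    ∀ i ≠ j, (ζ.2.get ⟨k, hk⟩).1 i = p.jointAct (ζ.take k) i

theorem FSPolicy.FirstDeviatorOnly.deviator_eq {p : FSPolicy G} {j : Fin n} {ζ : Traj G}
    (hζ : p.FirstDeviatorOnly j ζ) (h : p.Deviated ζ) : p.deviator ζ h = j := by
  classical
  by_contra hne
  have hdev : (ζ.2.get ⟨Nat.find h, (Nat.find_spec h).choose⟩).1 (p.deviator ζ h) ≠
      p.jointAct (ζ.take (Nat.find h)) (p.deviator ζ h) := by
    unfold FSPolicy.deviator
    exact (Finset.mem_filter.mp (Finset.min'_mem (Finset.univ.filter fun i : Fin n =>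
      (ζ.2.get ⟨Nat.find h, (Nat.find_spec h).choose⟩).1 i ≠
        p.jointAct (ζ.take (Nat.find h)) i) _)).2
  exact hdev (hζ _ _ (fun l hl => Nat.find_min h hl) _ hne)

theorem FSPolicy.FirstDeviatorOnly.compose_eq {p : FSPolicy G} {j : Fin n} {ζ : Traj G}
    (hζ : p.FirstDeviatorOnly j ζ) {τ τ' : PunishmentStrategies G}
    (hjj : ∀ (i : Fin n) (hij : i ≠ j), τ i j hij = τ' i j hij) :
    p.compose τ ζ = p.compose τ' ζ := by
  unfold FSPolicy.compose
  split_ifs with h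
  · have hd := hζ.deviator_eq h
    congr 1
    funext i
    split_ifs with hij
    · subst hd
      rw [hjj]
    · rfl
  · rfl

theorem FSPolicy.FirstDeviatorOnly.extend {p : FSPolicy G} {j : Fin n} {ζ : Traj G}
    (hζ : p.FirstDeviatorOnly j ζ) {a : ∀ i, G.A i} (s' : G.S)
    (ha : ¬ p.Deviated ζ → ∀ i ≠ j, a i = p.jointAct ζ i) :
    p.FirstDeviatorOnly j (ζ.extend a s') := by
  intro k hk hmin i hi
  have hlen : k < ζ.2.length + 1 := by simpa [Traj.extend] using hk
  rcases Nat.lt_succ_iff_lt_or_eq.mp hlen with hlt | rfl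
  · rw [Traj.take_extend ζ a s' hlt.le, ← hζ k hlt
      (fun l hl hd => hmin l hl ((p.devAt_extend_iff ζ a s' (hl.trans hlt)).mpr hd)) i hi]
    simp [Traj.extend, List.getElem_append_left hlt]
  · rw [Traj.take_extend ζ a s' le_rfl, Traj.take_length, ← ha ?_ i hi]
    · simp [Traj.extend]
    · rintro ⟨l, hl, hd⟩
      exact hmin l hl ((p.devAt_extend_iff ζ a s' hl).mpr ⟨hl, hd⟩)

theorem FSPolicy.firstDeviatorOnly_of_mem_support (p : FSPolicy G) (j : Fin n)
    (τ : PunishmentStrategies G) (π' : AgentPolicy G j) (t : ℕ) :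
    ∀ ζ ∈ (trajDist G (replace (p.compose τ) j π') t).support, p.FirstDeviatorOnly j ζ := by
  induction t with
  | zero =>
    intro ζ hζ k hk
    obtain rfl : ζ = (G.s0, []) := by simpa [trajDist] using hζ
    simp at hk
  | succ t ih =>
    intro ζ' hζ'
    simp only [trajDist, PMF.mem_support_bind_iff, stepDist, PMF.mem_support_map_iff] at hζ'
    obtain ⟨ζ, hζ, a, ha, s', -, rfl⟩ := hζ'
    refine (ih ζ hζ).extend s' fun hnd i hi => ?_
    simp only [replace, FSPolicy.compose, dif_neg hnd, PMF.mem_support_bind_iff,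
      PMF.mem_support_map_iff, PMF.mem_support_pure_iff] at ha
    obtain ⟨_, rfl, _, -, rfl⟩ := ha
    exact Function.update_of_ne hi _ _

theorem bind_congr_support {α β : Type*} (q : PMF α) {f g : α → PMF β}
    (h : ∀ a ∈ q.support, f a = g a) : q.bind f = q.bind g := by
  ext b
  simp only [PMF.bind_apply]
  refine tsum_congr fun a => ?_
  by_cases ha : q a = 0
  · simp [ha]
  · rw [h a ((q.mem_support_iff a).mpr ha)]

theorem FSPolicy.trajDist_replace_compose_congr (p : FSPolicy G) (j : Fin n)
    {τ τ' : PunishmentStrategies G}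
    (hjj : ∀ (i : Fin n) (hij : i ≠ j), τ i j hij = τ' i j hij) (π' : AgentPolicy G j) (t : ℕ) :
    trajDist G (replace (p.compose τ) j π') t = trajDist G (replace (p.compose τ') j π') t := by
  induction t with
  | zero => rfl
  | succ t ih =>
    rw [trajDist, trajDist, ← ih]
    refine bind_congr_support _ fun ζ hζ => ?_
    have hζ' := p.firstDeviatorOnly_of_mem_support j τ π' t ζ hζ
    simp only [stepDist, replace, hζ'.compose_eq hjj]

end MarkovGame

open MarkovGame in
/-- Let `π` be a finite-state deterministic joint policy, `j` an
agent, and `τ`, `τ'` two sets of punishment strategies with `τ[j] = τ'[j]`. Then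
for every alternate policy `π'_j` of agent `j`,
`J_j((π ⋈ τ)_{-j}, π'_j) = J_j((π ⋈ τ')_{-j}, π'_j)`; in particular the optimal
deviation value `max_{π'_j} J_j((π ⋈ τ)_{-j}, π'_j)` depends only on `τ[j]`. -/
theorem deviation_value_depends_only_on_tau_j
    {n : ℕ} {G : MarkovGame n} (φ : ∀ _ : Fin n, Traj G → Prop)
    (p : FSPolicy G) (j : Fin n) (τ τ' : PunishmentStrategies G)
    (hjj : ∀ (i : Fin n) (hij : i ≠ j), τ i j hij = τ' i j hij) :
    (∀ π'j : AgentPolicy G j,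
      G.score (φ j) (replace (p.compose τ) j π'j) =
        G.score (φ j) (replace (p.compose τ') j π'j)) ∧
    (⨆ π'j : AgentPolicy G j, G.score (φ j) (replace (p.compose τ) j π'j)) =
      ⨆ π'j : AgentPolicy G j, G.score (φ j) (replace (p.compose τ') j π'j) := by
  have h (π'j : AgentPolicy G j) : G.score (φ j) (replace (p.compose τ) j π'j) =
      G.score (φ j) (replace (p.compose τ') j π'j) := by
    rw [score, score, p.trajDist_replace_compose_congr j hjj]
  exact ⟨h, iSup_congr h⟩
end

section
/- Let π be a finite-state deterministic joint policy in an n-agent Markov game with Nash factor ε > 0, and let τ be a set of punishment strategies. If for every agent j, max over alternate policies π'_j of J_j((π ⋈ τ)_{−j}, π'_j) is at most J_j(π) + ε, then π ⋈ τ is an ε-Nash equilibrium. -/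
namespace MarkovGame

variable {n : ℕ} {G : MarkovGame n}

theorem score_le_one (φ : Traj G → Prop) (π : JointPolicy G) : G.score φ π ≤ 1 := by
  refine ENNReal.toReal_le_of_le_ofReal zero_le_one ?_
  rw [ENNReal.ofReal_one, PMF.toOuterMeasure_apply]
  refine le_trans (ENNReal.tsum_le_tsum fun ζ => ?_) (PMF.tsum_coe (trajDist G π G.H)).le
  exact Set.indicator_le_self _ _ ζ

namespace FSPolicy

theorem not_deviated_nil (p : FSPolicy G) (s : G.S) :
    ¬ p.Deviated ((s, []) : Traj G) := by
  rintro ⟨k, hk, -⟩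
  simp at hk

theorem not_deviated_extend_s4 (p : FSPolicy G) {ζ : Traj G} (h : ¬ p.Deviated ζ) (s' : G.S) :
    ¬ p.Deviated (Traj.extend ζ (p.jointAct ζ) s') := by
  rintro ⟨k, hk, hne⟩
  have hlen : k ≤ ζ.2.length := by
    simpa [Traj.extend, Nat.lt_succ_iff] using hk
  have htake : Traj.take (Traj.extend ζ (p.jointAct ζ) s') k = Traj.take ζ k := by
    simp [Traj.take, Traj.extend, List.take_append_of_le_length hlen]
  rw [htake] at hne
  rcases hlen.lt_or_eq with hlt | rfl
  · refine h ⟨k, hlt, ?_⟩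
    simpa [Traj.extend, List.getElem_append_left hlt] using hne
  · simp [Traj.extend, Traj.take] at hne

theorem not_deviated_of_mem_support_s4 (p : FSPolicy G) (t : ℕ) :
    ∀ ζ ∈ (trajDist G p.toJoint t).support, ¬ p.Deviated ζ := by
  induction t with
  | zero =>
    intro ζ hζ
    rw [trajDist, PMF.support_pure, Set.mem_singleton_iff] at hζ
    exact hζ ▸ p.not_deviated_nil G.s0
  | succ t ih =>
    intro ζ hζ
    rw [trajDist, PMF.mem_support_bind_iff] at hζ
    obtain ⟨ξ, hξ, hζ⟩ := hζ
    rw [stepDist, toJoint, PMF.pure_bind, PMF.mem_support_map_iff] at hζ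
    obtain ⟨s', -, rfl⟩ := hζ
    exact p.not_deviated_extend_s4 (ih ξ hξ) s'

theorem compose_eq_toJoint (p : FSPolicy G) (τ : PunishmentStrategies G) {ζ : Traj G}
    (h : ¬ p.Deviated ζ) : p.compose τ ζ = p.toJoint ζ := by
  simp [compose, toJoint, h]

theorem trajDist_compose_s4 (p : FSPolicy G) (τ : PunishmentStrategies G) (t : ℕ) :
    trajDist G (p.compose τ) t = trajDist G p.toJoint t := by
  induction t with
  | zero => rfl
  | succ t ih =>
    rw [trajDist, trajDist, ih]
    ext ζ
    rw [PMF.bind_apply, PMF.bind_apply]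
    refine tsum_congr fun ξ => ?_
    by_cases hξ : ξ ∈ (trajDist G p.toJoint t).support
    · rw [stepDist, stepDist, p.compose_eq_toJoint τ (p.not_deviated_of_mem_support_s4 t ξ hξ)]
    · rw [(PMF.apply_eq_zero_iff _ _).2 hξ, zero_mul, zero_mul]

theorem score_compose_s4 (p : FSPolicy G) (τ : PunishmentStrategies G) (φ : Traj G → Prop) :
    G.score φ (p.compose τ) = G.score φ p.toJoint := by
  rw [score, score, p.trajDist_compose_s4 τ]

end FSPolicy

end MarkovGame

open MarkovGame in
/-- Let `π` be a finite-state deterministic joint policy, `ε > 0`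
a Nash factor, and `τ` a set of punishment strategies. If for every agent `j` the
maximum over alternate policies `π'_j` of `J_j((π ⋈ τ)_{-j}, π'_j)` is at most
`J_j(π) + ε`, then `π ⋈ τ` is an `ε`-Nash equilibrium. -/
theorem punishment_bound_implies_nash
    {n : ℕ} {G : MarkovGame n} (φ : ∀ _ : Fin n, Traj G → Prop)
    (ε : ℝ) (hε : 0 < ε)
    (p : FSPolicy G) (τ : PunishmentStrategies G)
    (hdev : ∀ j : Fin n,
      (⨆ π'j : AgentPolicy G j, G.score (φ j) (replace (p.compose τ) j π'j)) ≤
        G.score (φ j) p.toJoint + ε) :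
    G.IsEpsNash φ (p.compose τ) ε := by
  intro j π'
  have hbdd : BddAbove (Set.range fun π'j : AgentPolicy G j =>
      G.score (φ j) (replace (p.compose τ) j π'j)) :=
    ⟨1, Set.forall_mem_range.2 fun _ => score_le_one _ _⟩
  rw [p.score_compose_s4 τ]
  linarith [le_ciSup hbdd π', hdev j]
end

section
/- For every SPECTRL specification φ over a finite state space S and finite joint action set A, there exists a reward machine R_φ = (Q, δ_u, δ_r, q0) such that for every trajectory ζ = s0 →a0 s1 →a1 · · · →a_t s_{t+1} of length t+1, R_φ(ζ) = 1 if ζ_{0:t} satisfies φ and R_φ(ζ) = 0 otherwise. -/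
open scoped Classical

/-- Syntax of SPECTRL specifications over predicates on a state space `S`. -/
inductive Spec (S : Type) where
  | achieve (b : S → Prop)
  | ensuring (φ : Spec S) (b : S → Prop)
  | seq (φ₁ φ₂ : Spec S)
  | choice (φ₁ φ₂ : Spec S)

/-- Satisfaction of a SPECTRL specification by a finite sequence of states
`s₀ s₁ … s_t`, given as a list. -/
def Spec.Sat {S : Type} : Spec S → List S → Prop
  | .achieve b, l => ∃ s ∈ l, b s
  | .ensuring φ b, l => φ.Sat l ∧ ∀ s ∈ l, b s
  | .seq φ₁ φ₂, l =>
      ∃ i : ℕ, i + 1 < l.length ∧ φ₁.Sat (l.take (i + 1)) ∧ φ₂.Sat (l.drop (i + 1))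
  | .choice φ₁ φ₂, l => φ₁.Sat l ∨ φ₂.Sat l

/-- A reward machine `R = (Q, δ_u, δ_r, q0)` over states `S` and (joint) actions `A`:
a finite set of states `Q`, a state transition function `δ_u`, a reward function
`δ_r` with values in `[-1, 1]`, and an initial state `q0`. -/
structure RewardMachine (S A : Type) where
  Q : Type
  fintQ : Fintype Q
  δu : S → A → Q → Q
  δr : S → Q → ℝ
  δr_mem : ∀ s q, δr s q ∈ Set.Icc (-1 : ℝ) 1
  q0 : Q

/-- The total reward collected by a reward machine started in state `q` at
environment state `s`, along the remaining steps of a trajectory: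
`R(ζ) = Σ_k δ_r(s_k, q_k)` with `q_{k+1} = δ_u(s_k, a_k, q_k)`. -/
def RewardMachine.rewardFrom {S A : Type} (R : RewardMachine S A) :
    S → R.Q → List (A × S) → ℝ
  | _, _, [] => 0
  | s, q, (a, s') :: rest => R.δr s q + R.rewardFrom s' (R.δu s a q) rest

/-- The reward `R(ζ)` assigned by a reward machine to a trajectory
`ζ = s₀ →a₀ s₁ →a₁ ⋯ →a_{t-1} s_t` (represented as an initial state together
with a list of (action, next state) steps). -/
def RewardMachine.reward {S A : Type} (R : RewardMachine S A) (ζ : S × List (A × S)) : ℝ :=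
  R.rewardFrom ζ.1 R.q0 ζ.2

/-- The sequence of states `s₀ s₁ … s_t` visited by a trajectory. -/
def trajStates {S A : Type} (ζ : S × List (A × S)) : List S := ζ.1 :: ζ.2.map Prod.snd

namespace DFA

/-- The automaton for the concatenation of two languages: it runs `M₁`, together with every run of
`M₂` started at a point where `M₁` accepts. -/
def concat {α σ₁ σ₂ : Type*} (M₁ : DFA α σ₁) (M₂ : DFA α σ₂) : DFA α (σ₁ × Set σ₂) where
  step p a := (M₁.step p.1 a,
    (M₂.step · a) '' p.2 ∪ {r | M₁.step p.1 a ∈ M₁.accept ∧ r = M₂.start})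
  start := (M₁.start, {r | M₁.start ∈ M₁.accept ∧ r = M₂.start})
  accept := {p | (p.2 ∩ M₂.accept).Nonempty}

theorem eval_concat {α σ₁ σ₂ : Type*} (M₁ : DFA α σ₁) (M₂ : DFA α σ₂) (x : List α) :
    (M₁.concat M₂).eval x =
      (M₁.eval x, {r | ∃ u v, u ++ v = x ∧ u ∈ M₁.accepts ∧ M₂.eval v = r}) := by
  induction x using List.reverseRecOn with
  | nil =>
    refine Prod.ext rfl (Set.ext fun r => ?_)
    simp [concat, mem_accepts, eq_comm]
  | append_singleton x a ih =>
    rw [eval_append_singleton, ih]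
    refine Prod.ext (by simp [concat]) (Set.ext fun r => ?_)
    simp only [concat, Set.mem_union, Set.mem_image, Set.mem_ofPred_eq]
    constructor
    · rintro (⟨_, ⟨u, v, rfl, hu, rfl⟩, rfl⟩ | ⟨h, rfl⟩)
      · exact ⟨u, v ++ [a], by simp, hu, by simp⟩
      · exact ⟨x ++ [a], [], by simp, by simpa [mem_accepts] using h, rfl⟩
    · rintro ⟨u, v, huv, hu, rfl⟩
      rcases v.eq_nil_or_concat' with rfl | ⟨w, b, rfl⟩
      · right
        obtain rfl : u = x ++ [a] := by simpa using huv
        exact ⟨by simpa [mem_accepts] using hu, rfl⟩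
      · left
        rw [← List.append_assoc] at huv
        obtain ⟨rfl, hb⟩ := List.append_inj' huv rfl
        obtain rfl : b = a := by simpa using hb
        exact ⟨M₂.eval w, ⟨u, w, rfl, hu, rfl⟩, by simp⟩

theorem accepts_concat {α σ₁ σ₂ : Type*} (M₁ : DFA α σ₁) (M₂ : DFA α σ₂) :
    (M₁.concat M₂).accepts = M₁.accepts * M₂.accepts := by
  ext x
  rw [mem_accepts, eval_concat, Language.mem_mul]
  constructor
  · rintro ⟨_, ⟨u, v, huv, hu, rfl⟩, hv⟩
    exact ⟨u, hu, v, hv, huv⟩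
  · rintro ⟨u, hu, v, hv, huv⟩
    exact ⟨_, ⟨u, v, huv, hu, rfl⟩, hv⟩

end DFA

namespace Language

theorem IsRegular.mul {α : Type*} {L₁ L₂ : Language α} (h₁ : L₁.IsRegular) (h₂ : L₂.IsRegular) :
    (L₁ * L₂).IsRegular := by
  obtain ⟨σ₁, _, M₁, rfl⟩ := h₁
  obtain ⟨σ₂, _, M₂, rfl⟩ := h₂
  exact ⟨_, inferInstance, M₁.concat M₂, M₁.accepts_concat M₂⟩

theorem isRegular_setOf_exists_mem {α : Type*} (b : α → Prop) :
    IsRegular ({l | ∃ s ∈ l, b s} : Set (List α)) := by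
  let M : DFA α Prop := ⟨fun p s => p ∨ b s, False, {p | p}⟩
  refine ⟨Prop, inferInstance, M, Set.ext fun l => ?_⟩
  change M.eval l ↔ ∃ s ∈ l, b s
  induction l using List.reverseRecOn with
  | nil => simp [M]
  | append_singleton l a ih =>
    rw [DFA.eval_append_singleton]
    change M.eval l ∨ b a ↔ _
    simp [ih, or_and_right, exists_or]

theorem isRegular_setOf_forall_mem {α : Type*} (b : α → Prop) :
    IsRegular ({l | ∀ s ∈ l, b s} : Set (List α)) := by
  have h : ({l | ∀ s ∈ l, b s} : Set (List α)) = {l | ∃ s ∈ l, ¬ b s}ᶜ := by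
    ext l
    simp
  exact h ▸ (isRegular_setOf_exists_mem fun s => ¬ b s).compl

end Language

namespace Spec

theorem not_sat_nil {S : Type} (φ : Spec S) : ¬ φ.Sat [] := by
  induction φ <;> simp_all [Sat]

/-- The language of state sequences satisfying a specification. -/
def language {S : Type} (φ : Spec S) : Language S := {l | φ.Sat l}

theorem mem_language {S : Type} {φ : Spec S} {l : List S} : l ∈ φ.language ↔ φ.Sat l := Iff.rfl

theorem language_seq {S : Type} (φ₁ φ₂ : Spec S) :
    (seq φ₁ φ₂).language = φ₁.language * φ₂.language := by
  ext l
  rw [Language.mem_mul]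
  constructor
  · rintro ⟨i, -, h₁, h₂⟩
    exact ⟨_, h₁, _, h₂, List.take_append_drop _ _⟩
  · rintro ⟨u, hu, v, hv, rfl⟩
    have hu0 : u ≠ [] := fun h => φ₁.not_sat_nil (h ▸ hu)
    have hv0 : v ≠ [] := fun h => φ₂.not_sat_nil (h ▸ hv)
    have hu1 := List.length_pos_iff.2 hu0
    have hv1 := List.length_pos_iff.2 hv0
    have hlen : u.length - 1 + 1 = u.length := by omega
    refine ⟨u.length - 1, ?_, ?_, ?_⟩
    · simp only [List.length_append]
      omega
    · simpa [hlen] using mem_language.1 hu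
    · simpa [hlen] using mem_language.1 hv

theorem isRegular_language {S : Type} (φ : Spec S) : φ.language.IsRegular := by
  induction φ with
  | achieve b => exact Language.isRegular_setOf_exists_mem b
  | ensuring φ b ih => exact ih.inf (Language.isRegular_setOf_forall_mem b)
  | seq φ₁ φ₂ ih₁ ih₂ => exact language_seq φ₁ φ₂ ▸ ih₁.mul ih₂
  | choice φ₁ φ₂ ih₁ ih₂ => exact ih₁.add ih₂

end Spec

/-- The reward machine that runs the automaton `M` on the visited states and pays the change of
the acceptance indicator at every step. -/
noncomputable def DFA.rewardMachine {S σ : Type} (A : Type) [Fintype σ] (M : DFA S σ) :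
    RewardMachine S A where
  Q := σ
  fintQ := inferInstance
  δu s _ q := M.step q s
  δr s q := M.accept.indicator 1 (M.step q s) - M.accept.indicator 1 q
  δr_mem s q := by
    simp only [Set.indicator_apply, Pi.one_apply, Set.mem_Icc]
    split_ifs <;> norm_num
  q0 := M.start

theorem DFA.rewardFrom_rewardMachine {S A σ : Type} [Fintype σ] (M : DFA S σ) (s : S) (q : σ)
    (l : List (A × S)) (p : A × S) :
    (M.rewardMachine A).rewardFrom s q (l ++ [p]) =
      M.accept.indicator 1 (M.evalFrom q (s :: l.map Prod.snd)) - M.accept.indicator 1 q := by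
  induction l generalizing s q with
  | nil => simp [RewardMachine.rewardFrom, rewardMachine]
  | cons p' l ih =>
    obtain ⟨a, s'⟩ := p'
    change (M.accept.indicator 1 (M.step q s) - M.accept.indicator 1 q) +
      (M.rewardMachine A).rewardFrom s' (M.step q s) (l ++ [p]) = _
    rw [ih]
    simp

/-- For every SPECTRL specification `φ` over a finite state space
`S` and finite joint action set `A`, there exists a reward machine `R_φ` such that
for every trajectory `ζ = s₀ →a₀ ⋯ →a_t s_{t+1}` of length `t+1` (i.e. having at
least one step), `R_φ(ζ) = 1` if the prefix `ζ_{0:t}` satisfies `φ`, and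
`R_φ(ζ) = 0` otherwise. -/
theorem spectrl_to_reward_machine {S A : Type} [Fintype S] [Fintype A] (φ : Spec S) :
    ∃ R : RewardMachine S A, ∀ ζ : S × List (A × S), ζ.2 ≠ [] →
      R.reward ζ = if Spec.Sat φ (trajStates (ζ.1, ζ.2.dropLast)) then 1 else 0 := by
  obtain ⟨σ, _, M, hM⟩ := φ.isRegular_language
  have accept_iff (l : List S) : M.evalFrom M.start l ∈ M.accept ↔ φ.Sat l := by
    rw [← Spec.mem_language, ← hM]
    rfl
  refine ⟨M.rewardMachine A, ?_⟩
  rintro ⟨s, l⟩ hl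
  obtain ⟨l, p, rfl⟩ := l.eq_nil_or_concat'.resolve_left hl
  have hstart : M.start ∉ M.accept := fun h => φ.not_sat_nil ((accept_iff []).1 h)
  have h := M.rewardFrom_rewardMachine s M.start l p
  simp only [Set.indicator_of_notMem hstart, sub_zero, Set.indicator_apply, accept_iff] at h
  exact h.trans (by simp [trajStates])
end
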